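/- O(1/n) convergence of the pre-relaxed block Jacobi method (distance form): let p⁽⁰⁾ ∈ C and for each n let p⁽ⁿ⁺¹⁾ = Σ_{k=1}^{N_c} R_k* t_k⁽ⁿ⁾, where t_k⁽ⁿ⁾ ∈ C_k is any minimizer of p_k ↦ F_k(N_c p_k − (N_c − 1) R_k p⁽ⁿ⁾; p⁽ⁿ⁾) over C_k, and let p* be a minimizer of F over C. Then for any n ≥ 1, F(p⁽ⁿ⁾) − F(p*) ≤ N_c · D(p*, p⁽⁰⁾) / n. -/

import Mathlib

open Finset

noncomputable section

/-- The discrete image domain of `M × N` pixels. -/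
abbrev Idx (M N : ℕ) := Fin M × Fin N

/-- The discrete divergence operator `div : W → V`, the negative adjoint of
the discrete gradient. -/
def divOp {M N : ℕ} (p : Idx M N → ℝ × ℝ) : Idx M N → ℝ := fun x =>
  ((if (x.1 : ℕ) + 1 < M then (p x).1 else 0)
    - (if 1 ≤ (x.1 : ℕ) then
        (p (⟨(x.1 : ℕ) - 1, lt_of_le_of_lt (Nat.sub_le _ _) x.1.isLt⟩, x.2)).1 else 0))
  + ((if (x.2 : ℕ) + 1 < N then (p x).2 else 0)
    - (if 1 ≤ (x.2 : ℕ) then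
        (p (x.1, ⟨(x.2 : ℕ) - 1, lt_of_le_of_lt (Nat.sub_le _ _) x.2.isLt⟩)).2 else 0))

/-- The discrete gradient operator `∇ : V → W`. -/
def gradOp {M N : ℕ} (u : Idx M N → ℝ) : Idx M N → ℝ × ℝ := fun x =>
  ((if h : (x.1 : ℕ) + 1 < M then u (⟨(x.1 : ℕ) + 1, h⟩, x.2) - u x else 0),
   (if h : (x.2 : ℕ) + 1 < N then u (x.1, ⟨(x.2 : ℕ) + 1, h⟩) - u x else 0))

/-- Euclidean inner product on `V`. -/
def innerV {M N : ℕ} (u v : Idx M N → ℝ) : ℝ := ∑ x, u x * v x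

/-- Euclidean inner product on `W`. -/
def innerW {M N : ℕ} (p q : Idx M N → ℝ × ℝ) : ℝ :=
  ∑ x, ((p x).1 * (q x).1 + (p x).2 * (q x).2)

/-- Squared Euclidean norm on `V`. -/
def normVsq {M N : ℕ} (u : Idx M N → ℝ) : ℝ := ∑ x, (u x) ^ 2

/-- Max (Euclidean-pointwise) norm on `W`. -/
def normWinf {M N : ℕ} (p : Idx M N → ℝ × ℝ) : ℝ :=
  ⨆ x : Idx M N, Real.sqrt ((p x).1 ^ 2 + (p x).2 ^ 2)

/-- The dual ROF energy `F(p) = (1/2)‖div p + α f‖₂²`. -/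
def F {M N : ℕ} (α : ℝ) (f : Idx M N → ℝ) (p : Idx M N → ℝ × ℝ) : ℝ :=
  (1 / 2) * normVsq (fun x => divOp p x + α * f x)

/-- The gradient of `F`, namely `∇F(q) = div*(div q + α f) = -∇(div q + α f)`. -/
def gradF {M N : ℕ} (α : ℝ) (f : Idx M N → ℝ) (q : Idx M N → ℝ × ℝ) :
    Idx M N → ℝ × ℝ :=
  fun x => - gradOp (fun y => divOp q y + α * f y) x

/-- The constraint set `C = {p ∈ W : |p_{ij}| ≤ 1 ∀ (i,j)}`. -/
def Cset (M N : ℕ) : Set (Idx M N → ℝ × ℝ) :=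
  {p | ∀ x, Real.sqrt ((p x).1 ^ 2 + (p x).2 ^ 2) ≤ 1}

/-- Restriction operator `R_k : W → W_k`. -/
def Rk {M N : ℕ} (S : Finset (Idx M N)) (p : Idx M N → ℝ × ℝ) :
    {x // x ∈ S} → ℝ × ℝ :=
  fun x => p x.1

/-- Extension-by-zero operator `R_k* : W_k → W`. -/
def Ek {M N : ℕ} (S : Finset (Idx M N)) (pk : {x // x ∈ S} → ℝ × ℝ) :
    Idx M N → ℝ × ℝ :=
  fun x => if h : x ∈ S then pk ⟨x, h⟩ else 0

/-- The orthogonal projection `R_k* R_k : W → W`. -/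
def projk {M N : ℕ} (S : Finset (Idx M N)) (p : Idx M N → ℝ × ℝ) :
    Idx M N → ℝ × ℝ :=
  fun x => if x ∈ S then p x else 0

/-- The local constraint set `C_k = R_k C`. -/
def Ck {M N : ℕ} (S : Finset (Idx M N)) : Set ({x // x ∈ S} → ℝ × ℝ) :=
  Rk S '' Cset M N

/-- The local energy `F_k(p_k; r) = F(R_k* p_k + (I - R_k* R_k) r)`. -/
def Fk {M N : ℕ} (α : ℝ) (f : Idx M N → ℝ) (S : Finset (Idx M N))
    (pk : {x // x ∈ S} → ℝ × ℝ) (r : Idx M N → ℝ × ℝ) : ℝ :=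
  F α f (Ek S pk + (r - projk S r))

/-- Euclidean inner product on `W_k`. -/
def innerWk {M N : ℕ} (S : Finset (Idx M N)) (pk qk : {x // x ∈ S} → ℝ × ℝ) : ℝ :=
  ∑ x : {x // x ∈ S}, ((pk x).1 * (qk x).1 + (pk x).2 * (qk x).2)

/-- The distance-like quantity `D(p,q) = Σ_k (1/2)‖div R_k* R_k (p - q)‖₂²`. -/
def Ddist {M N Nc : ℕ} (S : Fin Nc → Finset (Idx M N))
    (p q : Idx M N → ℝ × ℝ) : ℝ :=
  ∑ k, (1 / 2) * normVsq (divOp (projk (S k) (p - q)))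

/-- The rectangular subdomain `Ω_s` of size `m × n` indexed by `s : Fin Ms × Fin Ns`
(for an `M × N` image with `M = Ms * m`, `N = Ns * n`). -/
def block {M N Ms Ns : ℕ} (m n : ℕ) (s : Fin Ms × Fin Ns) : Finset (Idx M N) :=
  Finset.univ.filter fun x => (x.1 : ℕ) / m = (s.1 : ℕ) ∧ (x.2 : ℕ) / n = (s.2 : ℕ)

end

open scoped InnerProductSpace

lemma norm_sum_sq_le_card_mul {E ι : Type*} [SeminormedAddCommGroup E] [Fintype ι] (a : ι → E) :
    ‖∑ k, a k‖ ^ 2 ≤ (Fintype.card ι : ℝ) * ∑ k, ‖a k‖ ^ 2 := by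
  calc ‖∑ k, a k‖ ^ 2 ≤ (∑ k, ‖a k‖) ^ 2 := by
        gcongr
        exact norm_sum_le _ _
    _ ≤ _ := by simpa using sq_sum_le_card_mul_sum_sq (s := Finset.univ) (f := fun k => ‖a k‖)

section Abstract

variable {E : Type*} [NormedAddCommGroup E] [InnerProductSpace ℝ E]

/-- First-order optimality condition along a segment for a quadratic energy. -/
lemma inner_nonneg_of_norm_sq_le_segment (v w : E)
    (h : ∀ s : ℝ, 0 < s → s ≤ 1 → ‖v‖ ^ 2 ≤ ‖v + s • w‖ ^ 2) : 0 ≤ ⟪v, w⟫_ℝ := by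
  by_contra! hneg
  have key : ∀ s : ℝ, 0 < s → s ≤ 1 → 0 ≤ 2 * ⟪v, w⟫_ℝ + s * ‖w‖ ^ 2 := by
    intro s hs hs1
    have h1 := h s hs hs1
    rw [norm_add_sq_real, inner_smul_right, norm_smul, Real.norm_eq_abs, abs_of_pos hs] at h1
    have h2 : 0 ≤ s * (2 * ⟪v, w⟫_ℝ + s * ‖w‖ ^ 2) := by linarith
    exact nonneg_of_mul_nonneg_right h2 hs
  have hd : 0 < ‖w‖ ^ 2 - ⟪v, w⟫_ℝ := by nlinarith [sq_nonneg ‖w‖]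
  have h1 := key (-⟪v, w⟫_ℝ / (‖w‖ ^ 2 - ⟪v, w⟫_ℝ)) (by apply div_pos <;> linarith)
    (by rw [div_le_one hd]; nlinarith [sq_nonneg ‖w‖])
  have h2 : -⟪v, w⟫_ℝ / (‖w‖ ^ 2 - ⟪v, w⟫_ℝ) * ‖w‖ ^ 2 ≤ -⟪v, w⟫_ℝ := by
    rw [div_mul_eq_mul_div, div_le_iff₀ hd]
    nlinarith [sq_nonneg ‖w‖]
  linarith

/-- One step of a block proximal descent for a quadratic energy. -/
lemma block_descent {ι : Type*} [Fintype ι] (u : E) (a b : ι → E)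
    (h : ∀ k, 0 ≤ ⟪u + (Fintype.card ι : ℝ) • a k, b k⟫_ℝ) :
    (1 / 2) * ‖u + ∑ k, a k‖ ^ 2 - (1 / 2) * ‖u + ∑ k, (a k + b k)‖ ^ 2
      ≤ (Fintype.card ι : ℝ) *
        (∑ k, (1 / 2) * ‖a k + b k‖ ^ 2 - ∑ k, (1 / 2) * ‖b k‖ ^ 2) := by
  have hsum : 0 ≤ ∑ k, ⟪u + (Fintype.card ι : ℝ) • a k, b k⟫_ℝ :=
    Finset.sum_nonneg fun k _ => h k
  have hcs := norm_sum_sq_le_card_mul a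
  simp only [inner_add_left, real_inner_smul_left, Finset.sum_add_distrib,
    ← Finset.mul_sum, ← inner_sum] at hsum
  simp only [norm_add_sq_real, Finset.sum_add_distrib, inner_add_right, ← Finset.mul_sum]
  have hsq := sq_nonneg ‖∑ k, a k + ∑ k, b k‖
  rw [norm_add_sq_real] at hsq
  linarith

end Abstract

section Blocks

variable {M N : ℕ}

/-- The discrete divergence as a linear map into Euclidean space. -/
noncomputable def divLin (M N : ℕ) : (Idx M N → ℝ × ℝ) →ₗ[ℝ] EuclideanSpace ℝ (Idx M N) where
  toFun p := WithLp.toLp 2 (divOp p)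
  map_add' p q := by
    ext x
    simp only [divOp, PiLp.add_apply, Pi.add_apply, Prod.fst_add, Prod.snd_add]
    split_ifs <;> ring
  map_smul' c p := by
    ext x
    simp only [divOp, PiLp.smul_apply, Pi.smul_apply, Prod.smul_fst, Prod.smul_snd,
      smul_eq_mul, RingHom.id_apply]
    split_ifs <;> ring

/-- The orthogonal projection onto a block as a linear map. -/
noncomputable def projLin (S : Finset (Idx M N)) : (Idx M N → ℝ × ℝ) →ₗ[ℝ] (Idx M N → ℝ × ℝ) where
  toFun := projk S
  map_add' p q := by
    ext x <;> simp only [projk, Pi.add_apply] <;> split_ifs <;> simp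
  map_smul' c p := by
    ext x <;> simp only [projk, Pi.smul_apply, RingHom.id_apply] <;> split_ifs <;> simp

lemma normVsq_divOp (p : Idx M N → ℝ × ℝ) : normVsq (divOp p) = ‖divLin M N p‖ ^ 2 := by
  simp [normVsq, divLin, EuclideanSpace.norm_sq_eq]

lemma F_eq_norm_sq (α : ℝ) (f : Idx M N → ℝ) (p : Idx M N → ℝ × ℝ) :
    F α f p = (1 / 2) * ‖divLin M N p + α • WithLp.toLp 2 f‖ ^ 2 := by
  simp [F, normVsq, divLin, EuclideanSpace.norm_sq_eq]

lemma Ddist_eq_norm_sq {Nc : ℕ} (S : Fin Nc → Finset (Idx M N)) (p q : Idx M N → ℝ × ℝ) :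
    Ddist S p q = ∑ k, (1 / 2) * ‖divLin M N (projLin (S k) (p - q))‖ ^ 2 := by
  simp only [Ddist, normVsq_divOp]
  rfl

lemma Fk_prerelaxed (α : ℝ) (f : Idx M N → ℝ) (S : Finset (Idx M N)) (c : ℝ)
    (r q : Idx M N → ℝ × ℝ) :
    Fk α f S (c • Rk S r - (c - 1) • Rk S q) q = F α f (q + c • projLin S (r - q)) := by
  unfold Fk
  congr 1
  ext x <;> by_cases hx : x ∈ S <;> simp [Ek, Rk, projLin, projk, hx] <;> ring

lemma sum_projLin {Nc : ℕ} {S : Fin Nc → Finset (Idx M N)}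
    (hdisj : ∀ k l, k ≠ l → Disjoint (S k) (S l)) (hcover : ∀ x : Idx M N, ∃ k, x ∈ S k)
    (p : Idx M N → ℝ × ℝ) : ∑ k, projLin (S k) p = p := by
  funext x
  obtain ⟨k, hk⟩ := hcover x
  rw [Finset.sum_apply, Finset.sum_eq_single k]
  · simp [projLin, projk, hk]
  · intro l _ hl
    simp [projLin, projk, Finset.disjoint_left.mp (hdisj k l hl.symm) hk]
  · simp

lemma Rk_sum_Ek {Nc : ℕ} {S : Fin Nc → Finset (Idx M N)}
    (hdisj : ∀ k l, k ≠ l → Disjoint (S k) (S l))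
    (t : ∀ k : Fin Nc, {x // x ∈ S k} → ℝ × ℝ) (k : Fin Nc) :
    Rk (S k) (∑ l, Ek (S l) (t l)) = t k := by
  funext x
  rw [Rk, Finset.sum_apply, Finset.sum_eq_single k]
  · simp [Ek]
  · intro l _ hl
    simp [Ek, Finset.disjoint_left.mp (hdisj k l hl.symm) x.2]
  · simp

lemma mem_Cset_of_Rk_mem_Ck {Nc : ℕ} {S : Fin Nc → Finset (Idx M N)}
    (hcover : ∀ x : Idx M N, ∃ k, x ∈ S k) {p : Idx M N → ℝ × ℝ}
    (h : ∀ k, Rk (S k) p ∈ Ck (S k)) : p ∈ Cset M N := by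
  intro x
  obtain ⟨k, hk⟩ := hcover x
  obtain ⟨q, hq, hqp⟩ := h k
  have hx : q x = p x := congrFun hqp ⟨x, hk⟩
  exact hx ▸ hq x

lemma convex_Cset : Convex ℝ (Cset M N) := by
  intro p hp q hq a b ha hb hab x
  have h1 := hp x
  have h2 := hq x
  simp only [Real.sqrt_le_iff, zero_le_one, one_pow, true_and] at h1 h2 ⊢
  simp only [Pi.add_apply, Pi.smul_apply, Prod.fst_add, Prod.snd_add, Prod.smul_fst,
    Prod.smul_snd, smul_eq_mul]
  obtain rfl : b = 1 - a := by linarith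
  nlinarith [mul_nonneg (mul_nonneg ha hb) (sq_nonneg ((p x).1 - (q x).1)),
    mul_nonneg (mul_nonneg ha hb) (sq_nonneg ((p x).2 - (q x).2)),
    mul_le_mul_of_nonneg_left h1 ha, mul_le_mul_of_nonneg_left h2 hb]

/-- Three-point inequality for one pre-relaxed block Jacobi step from `q` to `w`. -/
lemma prerelaxed_step (α : ℝ) (f : Idx M N → ℝ) {Nc : ℕ} {S : Fin Nc → Finset (Idx M N)}
    (hdisj : ∀ k l, k ≠ l → Disjoint (S k) (S l)) (hcover : ∀ x : Idx M N, ∃ k, x ∈ S k)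
    {q w r : Idx M N → ℝ × ℝ} (hw : w ∈ Cset M N) (hr : r ∈ Cset M N)
    (hmin : ∀ k, ∀ v ∈ Cset M N, F α f (q + (Nc : ℝ) • projLin (S k) (w - q))
      ≤ F α f (q + (Nc : ℝ) • projLin (S k) (v - q))) :
    F α f w - F α f r ≤ (Nc : ℝ) * (Ddist S r q - Ddist S r w) := by
  have hopt : ∀ k, 0 ≤ ⟪(divLin M N q + α • WithLp.toLp 2 f)
      + (Fintype.card (Fin Nc) : ℝ) • divLin M N (projLin (S k) (w - q)),
      divLin M N (projLin (S k) (r - w))⟫_ℝ := by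
    intro k
    rw [Fintype.card_fin]
    have hN : (0 : ℝ) < Nc := by exact_mod_cast k.pos
    refine nonneg_of_mul_nonneg_right ?_ hN
    rw [← real_inner_smul_right]
    refine inner_nonneg_of_norm_sq_le_segment _ _ fun s hs hs1 => ?_
    have h := hmin k (w + s • (r - w))
      (convex_Cset.add_smul_sub_mem hw hr ⟨hs.le, hs1⟩)
    rw [F_eq_norm_sq, F_eq_norm_sq] at h
    have e : w + s • (r - w) - q = (w - q) + s • (r - w) := by abel
    rw [e] at h
    simp only [map_add, map_smul] at h
    rw [smul_add, smul_comm (Nc : ℝ) s, ← add_assoc] at h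
    simp only [add_right_comm _ _ (α • WithLp.toLp 2 f)] at h
    exact le_of_mul_le_mul_left h one_half_pos
  have h := block_descent (divLin M N q + α • WithLp.toLp 2 f)
    (fun k => divLin M N (projLin (S k) (w - q)))
    (fun k => divLin M N (projLin (S k) (r - w))) hopt
  simp only [← map_add, ← map_sum, sum_projLin hdisj hcover, Fintype.card_fin] at h
  have e : w - q + (r - w) = r - q := by abel
  rw [e] at h
  have hshift : ∀ v, divLin M N v + α • WithLp.toLp 2 f
      = divLin M N q + α • WithLp.toLp 2 f + divLin M N (v - q) := fun v => by
    rw [map_sub]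
    module
  rw [F_eq_norm_sq, F_eq_norm_sq, Ddist_eq_norm_sq, Ddist_eq_norm_sq, hshift w, hshift r]
  exact h

lemma Ddist_nonneg {Nc : ℕ} (S : Fin Nc → Finset (Idx M N)) (p q : Idx M N → ℝ × ℝ) :
    0 ≤ Ddist S p q := by
  rw [Ddist_eq_norm_sq]
  positivity

lemma Ddist_self {Nc : ℕ} (S : Fin Nc → Finset (Idx M N)) (p : Idx M N → ℝ × ℝ) :
    Ddist S p p = 0 := by
  simp [Ddist_eq_norm_sq]

end Blocks

theorem prerelaxed_jacobi_rate (M N : ℕ) (α : ℝ) (hα : 0 < α) (f : Idx M N → ℝ)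
    (Nc : ℕ) (S : Fin Nc → Finset (Idx M N))
    (hdisj : ∀ k l, k ≠ l → Disjoint (S k) (S l))
    (hcover : ∀ x : Idx M N, ∃ k, x ∈ S k)
    (p : ℕ → Idx M N → ℝ × ℝ) (hp0 : p 0 ∈ Cset M N)
    (t : ∀ _ : ℕ, ∀ k : Fin Nc, {x // x ∈ S k} → ℝ × ℝ)
    (ht : ∀ n k, t n k ∈ Ck (S k))
    (hmin : ∀ n k, ∀ rk ∈ Ck (S k),
      Fk α f (S k) ((Nc : ℝ) • t n k - ((Nc : ℝ) - 1) • Rk (S k) (p n)) (p n)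
        ≤ Fk α f (S k) ((Nc : ℝ) • rk - ((Nc : ℝ) - 1) • Rk (S k) (p n)) (p n))
    (hrec : ∀ n, p (n + 1) = ∑ k, Ek (S k) (t n k))
    (pstar : Idx M N → ℝ × ℝ) (hpstar : pstar ∈ Cset M N)
    (hstar : ∀ r ∈ Cset M N, F α f pstar ≤ F α f r)
    : ∀ n : ℕ, 1 ≤ n →
      F α f (p n) - F α f pstar ≤ (Nc : ℝ) * Ddist S pstar (p 0) / (n : ℝ) := by
  have hRk : ∀ n k, Rk (S k) (p (n + 1)) = t n k := fun n k => by
    rw [hrec, Rk_sum_Ek hdisj]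
  have hpC : ∀ n, p n ∈ Cset M N := by
    rintro (_ | n)
    · exact hp0
    · exact mem_Cset_of_Rk_mem_Ck hcover fun k => hRk n k ▸ ht n k
  have hstep : ∀ n, ∀ r ∈ Cset M N, F α f (p (n + 1)) - F α f r
      ≤ (Nc : ℝ) * (Ddist S r (p n) - Ddist S r (p (n + 1))) := by
    intro n r hr
    refine prerelaxed_step α f hdisj hcover (hpC (n + 1)) hr fun k v hv => ?_
    have h := hmin n k (Rk (S k) v) ⟨v, hv, rfl⟩
    rwa [← hRk, Fk_prerelaxed, Fk_prerelaxed] at h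
  have hmono : ∀ n, F α f (p (n + 1)) ≤ F α f (p n) := by
    intro n
    have h := hstep n (p n) (hpC n)
    rw [Ddist_self] at h
    have := mul_nonneg (Nat.cast_nonneg (α := ℝ) Nc) (Ddist_nonneg S (p n) (p (n + 1)))
    linarith
  have hsum : ∀ n : ℕ, (n : ℝ) * (F α f (p n) - F α f pstar)
      ≤ (Nc : ℝ) * (Ddist S pstar (p 0) - Ddist S pstar (p n)) := by
    intro n
    induction n with
    | zero => simp
    | succ n ih =>
      have h1 := hstep n pstar hpstar
      have h2 := mul_le_mul_of_nonneg_left (hmono n) (Nat.cast_nonneg (α := ℝ) n)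
      push_cast
      linarith
  intro n hn
  rw [le_div_iff₀ (by exact_mod_cast hn)]
  have := mul_nonneg (Nat.cast_nonneg (α := ℝ) Nc) (Ddist_nonneg S pstar (p n))
  linarith [hsum n]
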